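/- Suppose (H3) holds with p > 2. Let (λ_n, μ_n, u_n) be a sequence of solutions of (q) with μ_n → ∞ and λ_n → λ* for some λ* ∈ [0,∞). Let U(r) be a continuous function defined for all small r > 0 and assume either: (i) λ* ≠ 0 and for any ε ∈ (0,2) and L ∈ ℝ there exists r₀ ∈ (0,1) such that U_{2−ε}(r) ≤ U(r) ≤ V_L(r) for all r ∈ (0, r₀); or (ii) λ* = 0 and for any ε > 0 there exist r₀ ∈ (0,1) and L ∈ ℝ such that U_{2−ε}(r) ≤ U(r) ≤ V_L(r) for all r ∈ (0, r₀). Then, up to a subsequence, for every k ∈ ℕ ∪ {0} there exist sequences (r_{k,n}^±) ⊂ (0,1) such that u_n(r_{k,n}^±)/μ_n → δ_k, r_{k,n}^− < r_{k,n} < r_{k,n}^+, and u_n(r_{k,n}^±) = U(r_{k,n}^±) for all large n; in particular Z_{(0, r_{k,n}^+]}[u_n − U] ≥ 2(k+1) for all large n, and for any sequence (r_n) ⊂ (0,1) with u_n(r_n)/μ_n → 0 one has Z_{(0, r_n)}[u_n − U] → ∞. -/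

import Mathlib

open Filter

/-- The bubble sequences `(a_k)`, `(δ_k)` for `p > 2`. -/
def IsBubbleSeq (p : ℝ) (a δ : ℕ → ℝ) : Prop :=
  a 0 = 2 ∧ δ 0 = 1 ∧
  ∀ k : ℕ,
    δ (k + 1) ∈ Set.Ioo 0 (δ k) ∧
    2 * p / (2 + a k) * (1 - δ (k + 1) / δ k) - 1 + (δ (k + 1) / δ k) ^ p = 0 ∧
    a (k + 1) = 2 - (δ (k + 1) / δ k) ^ (p - 1) * (2 + a k) ∧
    a (k + 1) ∈ Set.Ioo (0:ℝ) 2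

/-- The comparison function `U_β(r) = (β log (1/r))^{1/p}`. -/
noncomputable def Ubeta (p β : ℝ) (r : ℝ) : ℝ := (β * Real.log (1 / r)) ^ (1 / p)

/-- The comparison function
`V_L(r) = {2 log(1/r) − (1 − (1−m)/p) log(2 log(1/r)) + L}^{1/p}`. -/
noncomputable def Vfun (p m L : ℝ) (r : ℝ) : ℝ :=
  (2 * Real.log (1 / r) -
    (1 - (1 - m) / p) * Real.log (2 * Real.log (1 / r)) + L) ^ (1 / p)

/-- `v` has at least `N` zeros on the set `I`. -/
def ZeroCountAtLeast (I : Set ℝ) (v : ℝ → ℝ) (N : ℕ) : Prop :=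
  ∃ S : Finset ℝ, ↑S ⊆ {x ∈ I | v x = 0} ∧ N ≤ S.card

/-- If `z(0) = 0` and `z'' ≤ -c e^z` on `[0, K]` with `c K² ≥ 48`, then `z` has dropped below `-1`
at `K`, however large `z'(0)` is. -/
lemma le_neg_one_of_deriv2_le_neg_exp {z z1 z2 : ℝ → ℝ} {c K : ℝ} (hc : 0 < c) (hK : 0 < K)
    (hcK : 48 ≤ c * K ^ 2)
    (hz : ∀ s ∈ Set.Icc 0 K, HasDerivAt z (z1 s) s)
    (hz1 : ∀ s ∈ Set.Icc 0 K, HasDerivAt z1 (z2 s) s)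
    (hz2 : ∀ s ∈ Set.Icc 0 K, z2 s ≤ -(c * Real.exp (z s))) (h0 : z 0 = 0) : z K ≤ -1 := by
  by_contra! hlt
  have hcont : ContinuousOn z (Set.Icc 0 K) := fun s hs => (hz s hs).continuousAt.continuousWithinAt
  have hconc : ConcaveOn ℝ (Set.Icc 0 K) z := by
    refine concaveOn_of_hasDerivWithinAt2_nonpos (convex_Icc 0 K) hcont (f' := z1) (f'' := z2)
      (fun s hs => (hz s (interior_subset hs)).hasDerivWithinAt)
      (fun s hs => (hz1 s (interior_subset hs)).hasDerivWithinAt) (fun s hs => ?_)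
    have := hz2 s (interior_subset hs)
    have := mul_pos hc (Real.exp_pos (z s))
    linarith
  have hlow : ∀ s ∈ Set.Icc 0 K, -1 ≤ z s := by
    intro s hs
    have hseg : s ∈ segment ℝ 0 K := by rwa [segment_eq_Icc hK.le]
    have := hconc.ge_on_segment (Set.left_mem_Icc.2 hK.le) (Set.right_mem_Icc.2 hK.le) hseg
    rw [h0] at this
    exact le_trans (le_min (by norm_num) hlt.le) this
  have hy : ∀ s ∈ Set.Icc 0 K, HasDerivAt (fun s => Real.exp (-z s / 2) - c / 8 * s ^ 2)
      (Real.exp (-z s / 2) * (-z1 s / 2) - c / 4 * s) s := by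
    intro s hs
    have h1 := ((hz s hs).neg.div_const 2).exp
    have h2 := ((hasDerivAt_id s).pow 2).const_mul (c / 8)
    refine (h1.sub h2).congr_deriv ?_
    simp; ring
  have hy1 : ∀ s ∈ Set.Icc 0 K,
      HasDerivAt (fun s => Real.exp (-z s / 2) * (-z1 s / 2) - c / 4 * s)
      (Real.exp (-z s / 2) * (z1 s ^ 2 / 4 - z2 s / 2) - c / 4) s := by
    intro s hs
    have h1 := ((hz s hs).neg.div_const 2).exp
    have h2 := h1.mul ((hz1 s hs).neg.div_const 2)
    have h3 := (hasDerivAt_id s).const_mul (c / 4)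
    refine (h2.sub h3).congr_deriv ?_
    simp; ring
  have hconv : ConvexOn ℝ (Set.Icc 0 K) (fun s => Real.exp (-z s / 2) - c / 8 * s ^ 2) := by
    refine convexOn_of_hasDerivWithinAt2_nonneg (convex_Icc 0 K)
      (fun s hs => (hy s hs).continuousAt.continuousWithinAt)
      (fun s hs => (hy s (interior_subset hs)).hasDerivWithinAt)
      (fun s hs => (hy1 s (interior_subset hs)).hasDerivWithinAt) (fun s hs => ?_)
    have hs := interior_subset hs
    have e1 : Real.exp (-z s / 2) * Real.exp (z s) = Real.exp (z s / 2) := by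
      rw [← Real.exp_add]; congr 1; ring
    have e2 : z s / 2 + 1 ≤ Real.exp (z s / 2) := Real.add_one_le_exp _
    have e3 := hlow s hs
    have e4 := Real.exp_pos (-z s / 2)
    have e5 := mul_le_mul_of_nonneg_left (hz2 s hs) e4.le
    have e6 : 0 ≤ Real.exp (-z s / 2) * (z1 s ^ 2 / 4) := by positivity
    have e7 : c * (1 / 2) ≤ c * Real.exp (z s / 2) := by gcongr; linarith
    have e8 : Real.exp (-z s / 2) * (-(c * Real.exp (z s))) = -(c * Real.exp (z s / 2)) := by
      rw [← e1]; ring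
    linarith
  have hmid := hconv.2 (Set.left_mem_Icc.2 hK.le) (Set.right_mem_Icc.2 hK.le)
    (by norm_num : (0:ℝ) ≤ 1 / 2) (by norm_num : (0:ℝ) ≤ 1 / 2) (by norm_num)
  simp only [smul_eq_mul, h0] at hmid
  have e1 := Real.exp_pos (-z (1 / 2 * 0 + 1 / 2 * K) / 2)
  have e2 : Real.exp (-z K / 2) < 2 := by
    have : Real.exp (-z K / 2) ≤ Real.exp (1 / 2) := Real.exp_le_exp.2 (by linarith)
    have h3 : Real.exp (1 / 2) ^ 2 = Real.exp 1 := by rw [← Real.exp_nat_mul]; norm_num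
    have := Real.exp_one_lt_d9
    nlinarith [Real.exp_pos (1 / 2)]
  norm_num at hmid e1
  nlinarith

lemma concaveOn_le_of_nonneg {w : ℝ → ℝ} (hw : ConcaveOn ℝ (Set.Ici 0) w) (h0 : 0 ≤ w 0)
    {s t : ℝ} (hs : 0 ≤ s) (hst : s ≤ t) : s * w t ≤ t * w s := by
  rcases hs.eq_or_lt with rfl | hs
  · simpa using mul_nonneg hst h0
  have ht : 0 < t := hs.trans_le hst
  have := hw.2 (Set.mem_Ici.2 le_rfl) (Set.mem_Ici.2 ht.le)
    (sub_nonneg.2 ((div_le_one ht).2 hst)) (div_nonneg hs.le ht.le) (by ring)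
  simp only [smul_eq_mul, mul_zero, zero_add, div_mul_cancel₀ s ht.ne'] at this
  have h1 : 0 ≤ (1 - s / t) * w 0 := mul_nonneg (sub_nonneg.2 ((div_le_one ht).2 hst)) h0
  have h2 : s / t * w t ≤ w s := by linarith
  calc s * w t = t * (s / t * w t) := by field_simp
    _ ≤ t * w s := by gcongr

lemma ConcaveOn.monotoneOn_of_nonneg {w : ℝ → ℝ} (hw : ConcaveOn ℝ (Set.Ici 0) w)
    (hpos : ∀ t, 0 ≤ t → 0 ≤ w t) : MonotoneOn w (Set.Ici 0) := by
  intro s hs t ht hst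
  by_contra! hlt
  have hs' : (0:ℝ) ≤ s := hs
  have hst' : s < t := lt_of_le_of_ne hst (by rintro rfl; exact lt_irrefl _ hlt)
  set d := w s - w t with hd
  have hdpos : 0 < d := sub_pos.2 hlt
  set r := t + (w t + 1) * (t - s) / d with hr
  have hwt := hpos t ht
  have htr : t < r := by
    have : 0 < (w t + 1) * (t - s) / d := by
      have := sub_pos.2 hst'
      positivity
    linarith
  have hsl := hw.slope_anti_adjacent hs (Set.mem_Ici.2 (hs'.trans (hst.trans htr.le))) hst' htr
  have hwr := hpos r (hs'.trans (hst.trans htr.le))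
  rw [div_le_div_iff₀ (by linarith) (by linarith)] at hsl
  have hrt : (r - t) * d = (w t + 1) * (t - s) := by
    rw [hr]; field_simp; ring
  have hts := sub_pos.2 hst'
  have : (w t - w s) * (r - t) = -((w t + 1) * (t - s)) := by rw [← hrt, hd]; ring
  nlinarith
lemma ConcaveOn.abs_sub_mul_le {w : ℝ → ℝ} (hw : ConcaveOn ℝ (Set.Ici 0) w)
    (hpos : ∀ t, 0 ≤ t → 0 ≤ w t) {s t : ℝ} (hs : 0 ≤ s) (ht : 0 ≤ t) :
    |w s - w t| * t ≤ w t * |s - t| := by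
  have hmono := hw.monotoneOn_of_nonneg hpos
  rcases le_total s t with h | h
  · have h1 := concaveOn_le_of_nonneg hw (hpos 0 le_rfl) hs h
    have h2 := hmono hs ht h
    rw [abs_of_nonpos (by linarith), abs_of_nonpos (by linarith)]
    linarith
  · have h1 := concaveOn_le_of_nonneg hw (hpos 0 le_rfl) ht h
    have h2 := hmono ht hs h
    rw [abs_of_nonneg (by linarith), abs_of_nonneg (by linarith)]
    linarith

lemma two_rpow_neg_abs_mul_le_rpow {m x y : ℝ} (hx : 0 < x) (h1 : x / 2 ≤ y) (h2 : y ≤ 2 * x) :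
    2 ^ (-|m|) * x ^ m ≤ y ^ m := by
  have hy : 0 < y := by linarith
  rcases le_total 0 m with hm | hm
  · rw [abs_of_nonneg hm, Real.rpow_neg (by norm_num), ← Real.inv_rpow (by norm_num),
      ← Real.mul_rpow (by norm_num) hx.le]
    exact Real.rpow_le_rpow (by positivity) (by linarith) hm
  · rw [abs_of_nonpos hm, neg_neg, ← Real.mul_rpow (by norm_num) hx.le]
    exact Real.rpow_le_rpow_of_nonpos hy h2 hm

lemma add_mul_sub_le_rpow {p x y : ℝ} (hp : 1 ≤ p) (hx : 0 < x) (hy : 0 ≤ y) :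
    x ^ p + p * x ^ (p - 1) * (y - x) ≤ y ^ p := by
  have h := one_add_mul_self_le_rpow_one_add (s := y / x - 1)
    (by have := div_nonneg hy hx.le; linarith) hp
  rw [add_sub_cancel, Real.div_rpow hy hx.le, le_div_iff₀ (Real.rpow_pos_of_pos hx p)] at h
  have e : x ^ p = x ^ (p - 1) * x := by rw [← Real.rpow_add_one hx.ne']; congr 1; ring
  calc x ^ p + p * x ^ (p - 1) * (y - x) = (1 + p * (y / x - 1)) * x ^ p := by
        rw [e]; field_simp
    _ ≤ y ^ p := h

lemma exp_mul_le_of_expGrowth {p m c₀ τ₀ : ℝ} {f : ℝ → ℝ} (hp : 1 ≤ p) (hc₀ : 0 < c₀)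
    (hτ₀ : 0 < τ₀) (hf : ∀ t, τ₀ ≤ t → f t = c₀ * t ^ m * Real.exp (t ^ p))
    {x y : ℝ} (hx : 2 * τ₀ ≤ x) (h1 : x / 2 ≤ y) (h2 : y ≤ 2 * x) :
    2 ^ (-|m|) * f x * Real.exp (p * x ^ (p - 1) * (y - x)) ≤ f y := by
  have hx0 : 0 < x := by linarith
  rw [hf x (by linarith), hf y (by linarith)]
  calc 2 ^ (-|m|) * (c₀ * x ^ m * Real.exp (x ^ p)) * Real.exp (p * x ^ (p - 1) * (y - x))
      = c₀ * (2 ^ (-|m|) * x ^ m) * Real.exp (x ^ p + p * x ^ (p - 1) * (y - x)) := by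
        rw [Real.exp_add]; ring
    _ ≤ c₀ * y ^ m * Real.exp (y ^ p) := by
        have := two_rpow_neg_abs_mul_le_rpow (m := m) hx0 h1 h2
        have h3 := add_mul_sub_le_rpow hp hx0 (by linarith : 0 ≤ y)
        have : 0 ≤ y ^ m := Real.rpow_nonneg (by linarith) m
        gcongr

/-- Near a point `t` where `p λ e^{-2t} w^{p-1} f(w)` is bounded below, the graph of a solution of
`w'' = -λ e^{-2t} f(w)` bends strictly away from the line of slope `2 / (p w(t)^{p-1})`,
on both sides (`e = ±1`). -/
lemma ConcaveOn.le_add_of_bubble {p m c₀ τ₀ lam : ℝ} {f w w1 : ℝ → ℝ} (hp : 1 ≤ p) (hc₀ : 0 < c₀)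
    (hτ₀ : 0 < τ₀) (hlam : 0 < lam)
    (hf : ∀ t, τ₀ ≤ t → f t = c₀ * t ^ m * Real.exp (t ^ p))
    (hconc : ConcaveOn ℝ (Set.Ici 0) w) (hpos : ∀ t, 0 ≤ t → 0 ≤ w t)
    (hw : ∀ t, 0 < t → HasDerivAt w (w1 t) t)
    (hw1 : ∀ t, 0 < t → HasDerivAt w1 (-(lam * Real.exp (-2 * t) * f (w t))) t)
    {t K e s : ℝ} (hK : 0 < K) (he : e = 1 ∨ e = -1) (htK : 2 * K ≤ t) (hwt : 2 * τ₀ ≤ w t)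
    (hcK : 48 * 2 ^ |m| ≤ (p * lam * Real.exp (-2 * t) * w t ^ (p - 1) * f (w t)) * K ^ 2)
    (hsK : K ≤ s) (hts : 0 ≤ t + e * s) :
    p * w t ^ (p - 1) * (w (t + e * s) - w t) ≤ (2 * e - 1 / K) * s := by
  have ht : 0 < t := by linarith
  have hwt0 : 0 < w t := by linarith
  have hs : 0 < s := by linarith
  have he2 : e * e = 1 := by rcases he with rfl | rfl <;> norm_num
  have heabs : |e| = 1 := by rcases he with rfl | rfl <;> norm_num
  set P := p * w t ^ (p - 1) with hP
  have hP0 : 0 < P := mul_pos (by linarith) (Real.rpow_pos_of_pos hwt0 _)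
  have hpos' : ∀ r ∈ Set.Icc 0 K, t / 2 ≤ t + e * r := by
    intro r hr
    have : |e * r| ≤ K := by rw [abs_mul, heabs, one_mul, abs_of_nonneg hr.1]; exact hr.2
    linarith [neg_abs_le (e * r)]
  set c := (2:ℝ) ^ (-|m|) * (P * lam * Real.exp (-2 * t) * f (w t)) with hc
  have hft : 0 < f (w t) := by
    rw [hf _ (by linarith)]
    have := Real.rpow_pos_of_pos hwt0 m
    positivity
  have h2m : (0:ℝ) < 2 ^ |m| := Real.rpow_pos_of_pos (by norm_num) _
  have hc0 : 0 < c := by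
    have := Real.rpow_pos_of_pos (by norm_num : (0:ℝ) < 2) (-|m|)
    have := Real.exp_pos (-2 * t)
    positivity
  have hkink : P * (w (t + e * K) - w t) - 2 * e * K ≤ -1 := by
    refine le_neg_one_of_deriv2_le_neg_exp
      (z := fun r => P * (w (t + e * r) - w t) - 2 * e * r)
      (z1 := fun r => P * (w1 (t + e * r) * e) - 2 * e)
      (z2 := fun r => P * (-(lam * Real.exp (-2 * (t + e * r)) * f (w (t + e * r)))))
      hc0 hK ?_ ?_ ?_ ?_ (by simp)
    · rw [hc, Real.rpow_neg (by norm_num)]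
      rw [show (2 ^ |m|)⁻¹ * (P * lam * Real.exp (-2 * t) * f (w t)) * K ^ 2
        = ((p * lam * Real.exp (-2 * t) * w t ^ (p - 1) * f (w t)) * K ^ 2) / 2 ^ |m| by
          rw [hP]; field_simp, le_div_iff₀ h2m]
      exact hcK
    · intro r hr
      have hin : HasDerivAt (fun r => t + e * r) e r := by
        simpa using ((hasDerivAt_id r).const_mul e).const_add t
      have h1 := (hw (t + e * r) (by linarith [hpos' r hr])).comp r hin
      have h2 := (hasDerivAt_id r).const_mul (2 * e)
      refine (((h1.sub_const (w t)).const_mul P).sub h2).congr_deriv ?_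
      simp
    · intro r hr
      have hin : HasDerivAt (fun r => t + e * r) e r := by
        simpa using ((hasDerivAt_id r).const_mul e).const_add t
      have h1 := (hw1 (t + e * r) (by linarith [hpos' r hr])).comp r hin
      refine (((h1.mul_const e).const_mul P).sub_const (2 * e)).congr_deriv ?_
      rw [mul_assoc _ e e, he2, mul_one]
    · intro r hr
      have hr1 := hpos' r hr
      have hab := hconc.abs_sub_mul_le hpos (s := t + e * r) (by linarith) ht.le
      have h1 : |w (t + e * r) - w t| ≤ w t / 2 := by
        have h3 : |t + e * r - t| ≤ t / 2 := by
          rw [add_sub_cancel_left, abs_mul, heabs, one_mul, abs_of_nonneg hr.1]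
          linarith [hr.2]
        have h4 : |w (t + e * r) - w t| * t ≤ w t / 2 * t := by nlinarith
        exact le_of_mul_le_mul_right h4 ht
      rw [abs_le] at h1
      have h2 := exp_mul_le_of_expGrowth hp hc₀ hτ₀ hf hwt (y := w (t + e * r))
        (by linarith) (by linarith)
      rw [mul_neg, neg_le_neg_iff]
      calc c * Real.exp (P * (w (t + e * r) - w t) - 2 * e * r)
          = P * (lam * Real.exp (-2 * (t + e * r)) *
              (2 ^ (-|m|) * f (w t) * Real.exp (P * (w (t + e * r) - w t)))) := by
            rw [hc, sub_eq_add_neg, Real.exp_add,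
              show -2 * (t + e * r) = -2 * t + -(2 * e * r) by ring, Real.exp_add]
            ring
        _ ≤ _ := by gcongr
  have hcomb := hconc.2 (Set.mem_Ici.2 ht.le) (Set.mem_Ici.2 hts)
    (sub_nonneg.2 ((div_le_one hs).2 hsK)) (div_nonneg hK.le hs.le) (by ring)
  simp only [smul_eq_mul] at hcomb
  rw [show (1 - K / s) * t + K / s * (t + e * s) = t + e * K by field_simp; ring] at hcomb
  have h1 : K / s * (w (t + e * s) - w t) ≤ w (t + e * K) - w t := by linarith
  have h2 : P * (K / s * (w (t + e * s) - w t)) ≤ 2 * e * K - 1 := by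
    have := mul_le_mul_of_nonneg_left h1 hP0.le
    linarith
  calc P * (w (t + e * s) - w t) = s / K * (P * (K / s * (w (t + e * s) - w t))) := by
        field_simp
    _ ≤ s / K * (2 * e * K - 1) := by gcongr
    _ = (2 * e - 1 / K) * s := by field_simp

/-- A radial solution in the variable `t = log (1 / r)`. -/
lemma radial_solution_log_coordinates {lam : ℝ} {f u : ℝ → ℝ} (hlam : 0 < lam)
    (hfpos : ∀ x, 0 ≤ x → 0 ≤ f x)
    (huC2 : ContDiffOn ℝ 2 u (Set.Icc 0 1))
    (hupos : ∀ r ∈ Set.Ico (0:ℝ) 1, 0 < u r)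
    (heq : ∀ r ∈ Set.Ioo (0:ℝ) 1, -(deriv (deriv u) r) - deriv u r / r = lam * f (u r)) :
    (∀ t, 0 < t → HasDerivAt (fun t => u (Real.exp (-t)))
      (-(Real.exp (-t) * deriv u (Real.exp (-t)))) t) ∧
    (∀ t, 0 < t → HasDerivAt (fun t => -(Real.exp (-t) * deriv u (Real.exp (-t))))
      (-(lam * Real.exp (-2 * t) * f (u (Real.exp (-t))))) t) ∧
    ConcaveOn ℝ (Set.Ici 0) (fun t => u (Real.exp (-t))) := by
  have hmem : ∀ t : ℝ, 0 < t → Real.exp (-t) ∈ Set.Ioo (0:ℝ) 1 := fun t ht =>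
    ⟨Real.exp_pos _, Real.exp_lt_one_iff.2 (by linarith)⟩
  have hC2 : ContDiffOn ℝ 2 u (Set.Ioo 0 1) := huC2.mono Set.Ioo_subset_Icc_self
  have hC1 : ContDiffOn ℝ 1 (deriv u) (Set.Ioo 0 1) := hC2.deriv_of_isOpen isOpen_Ioo (by norm_num)
  have hd : ∀ r ∈ Set.Ioo (0:ℝ) 1, HasDerivAt u (deriv u r) r := fun r hr =>
    ((hC2.differentiableOn (by norm_num)).differentiableAt (isOpen_Ioo.mem_nhds hr)).hasDerivAt
  have hd2 : ∀ r ∈ Set.Ioo (0:ℝ) 1, HasDerivAt (deriv u) (deriv (deriv u) r) r := fun r hr =>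
    ((hC1.differentiableOn (by norm_num)).differentiableAt (isOpen_Ioo.mem_nhds hr)).hasDerivAt
  have hexp : ∀ t : ℝ, HasDerivAt (fun t => Real.exp (-t)) (-Real.exp (-t)) t := fun t => by
    simpa using (hasDerivAt_neg t).exp
  have h1 : ∀ t, 0 < t → HasDerivAt (fun t => u (Real.exp (-t)))
      (-(Real.exp (-t) * deriv u (Real.exp (-t)))) t := fun t ht => by
    refine ((hd _ (hmem t ht)).comp t (hexp t)).congr_deriv ?_
    ring
  have h2 : ∀ t, 0 < t → HasDerivAt (fun t => -(Real.exp (-t) * deriv u (Real.exp (-t))))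
      (-(lam * Real.exp (-2 * t) * f (u (Real.exp (-t))))) t := fun t ht => by
    refine ((hexp t).mul ((hd2 _ (hmem t ht)).comp t (hexp t))).neg.congr_deriv ?_
    have h := heq _ (hmem t ht)
    have hpos := Real.exp_pos (-t)
    rw [show -2 * t = -t + -t by ring, Real.exp_add]
    simp only [Function.comp]
    rw [show lam * (Real.exp (-t) * Real.exp (-t)) * f (u (Real.exp (-t)))
      = Real.exp (-t) * Real.exp (-t) * (lam * f (u (Real.exp (-t)))) by ring, ← h]
    field_simp
    ring
  refine ⟨h1, h2, ?_⟩
  refine concaveOn_of_hasDerivWithinAt2_nonpos (convex_Ici 0) ?_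
    (f' := fun t => -(Real.exp (-t) * deriv u (Real.exp (-t))))
    (f'' := fun t => -(lam * Real.exp (-2 * t) * f (u (Real.exp (-t)))))
      (fun t ht => ?_) (fun t ht => ?_) (fun t ht => ?_)
  · refine huC2.continuousOn.comp (by fun_prop) fun t ht => ?_
    exact ⟨(Real.exp_pos _).le, Real.exp_le_one_iff.2 (neg_nonpos.2 ht)⟩
  · rw [interior_Ici] at ht
    exact (h1 t ht).hasDerivWithinAt
  · rw [interior_Ici] at ht
    exact (h2 t ht).hasDerivWithinAt
  · rw [interior_Ici] at ht
    have hr := hmem t ht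
    have := hfpos _ (hupos _ ⟨hr.1.le, hr.2⟩).le
    have := Real.exp_pos (-2 * t)
    rw [neg_nonpos]
    positivity
namespace IsBubbleSeq

variable {p : ℝ} {a δ : ℕ → ℝ}

lemma delta_pos (hb : IsBubbleSeq p a δ) (k : ℕ) : 0 < δ k := by
  cases k with
  | zero => rw [hb.2.1]; norm_num
  | succ k => exact (hb.2.2 k).1.1

lemma a_pos (hb : IsBubbleSeq p a δ) (k : ℕ) : 0 < a k := by
  cases k with
  | zero => rw [hb.1]; norm_num
  | succ k => exact (hb.2.2 k).2.2.2.1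

lemma a_le_two (hb : IsBubbleSeq p a δ) (k : ℕ) : a k ≤ 2 := by
  cases k with
  | zero => rw [hb.1]
  | succ k => exact (hb.2.2 k).2.2.2.2.le

lemma delta_strictAnti (hb : IsBubbleSeq p a δ) : StrictAnti δ :=
  strictAnti_nat_of_succ_lt fun k => (hb.2.2 k).1.2

end IsBubbleSeq

/-- The inequality `N sinh y ≤ sinh (N y)` for `N = 2 p - 1`, written in the variable
`x = exp (-2 y)`. -/
lemma mul_rpow_mul_one_sub_le {p x : ℝ} (hp : 1 ≤ p) (hx : 0 < x) (hx1 : x ≤ 1) :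
    (2 * p - 1) * x ^ (p - 1) * (1 - x) ≤ 1 - x ^ (2 * p - 1) := by
  let F : ℝ → ℝ := fun y => 1 - y ^ (2 * p - 1) - (2 * p - 1) * (y ^ (p - 1) - y ^ p)
  have hF : ∀ y ∈ Set.Icc x 1, HasDerivAt F
      (-((2 * p - 1) * y ^ (2 * p - 1 - 1))
        - (2 * p - 1) * ((p - 1) * y ^ (p - 1 - 1) - p * y ^ (p - 1))) y := by
    intro y hy
    have hy0 : y ≠ 0 := (hx.trans_le hy.1).ne'
    have h1 := (Real.hasDerivAt_rpow_const (p := 2 * p - 1) (Or.inl hy0)).const_sub 1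
    have h2 := Real.hasDerivAt_rpow_const (p := p - 1) (Or.inl hy0)
    have h3 := Real.hasDerivAt_rpow_const (p := p) (Or.inl hy0)
    exact h1.sub ((h2.sub h3).const_mul (2 * p - 1))
  have hanti : AntitoneOn F (Set.Icc x 1) := by
    refine antitoneOn_of_hasDerivWithinAt_nonpos (convex_Icc x 1)
      (fun y hy => (hF y hy).continuousAt.continuousWithinAt)
      (fun y hy => (hF y (interior_subset hy)).hasDerivWithinAt) (fun y hy => ?_)
    have hy := interior_subset hy
    have hy0 : 0 < y := hx.trans_le hy.1
    have e1 : y ^ (2 * p - 1 - 1) = y ^ (p - 1 - 1) * y ^ p := by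
      rw [← Real.rpow_add hy0]; congr 1; ring
    have e2 : y ^ (p - 1) = y ^ (p - 1 - 1) * y := by
      rw [← Real.rpow_add_one hy0.ne']; congr 1; ring
    have e3 : 1 + p * (y - 1) ≤ y ^ p := by
      simpa using one_add_mul_self_le_rpow_one_add (s := y - 1) (by linarith) hp
    have e4 := Real.rpow_pos_of_pos hy0 (p - 1 - 1)
    rw [e1, e2]
    have : 0 ≤ (2 * p - 1) * y ^ (p - 1 - 1) * (y ^ p - (1 + p * (y - 1))) := by
      apply mul_nonneg (mul_nonneg (by linarith) e4.le); linarith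
    linarith
  have := hanti (Set.left_mem_Icc.2 hx1) (Set.right_mem_Icc.2 hx1) hx1
  simp only [F, Real.one_rpow] at this
  have e : x ^ p = x ^ (p - 1) * x := by rw [← Real.rpow_add_one hx.ne']; congr 1; ring
  rw [e] at this
  linarith

namespace IsBubbleSeq

variable {p : ℝ} {a δ : ℕ → ℝ}

/-- `a_k δ_k^{1 - p}` is nondecreasing, hence at least its initial value `2`. -/
lemma two_mul_delta_rpow_le_a (hb : IsBubbleSeq p a δ) (hp : 1 ≤ p) (k : ℕ) :
    2 * δ k ^ (p - 1) ≤ a k := by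
  induction k with
  | zero => rw [hb.1, hb.2.1]; simp
  | succ k ih =>
    obtain ⟨hδ, he, ha, -⟩ := hb.2.2 k
    have hδk := hb.delta_pos k
    have hak := hb.a_pos k
    set x := δ (k + 1) / δ k with hx
    have hx0 : 0 < x := div_pos hδ.1 hδk
    have hx1 : x < 1 := (div_lt_one hδk).2 hδ.2
    have hδx : δ (k + 1) = x * δ k := by rw [hx]; field_simp
    have hxp := Real.rpow_pos_of_pos hx0 (p - 1)
    have key := mul_rpow_mul_one_sub_le hp hx0 hx1.le
    have e1 : x ^ p = x ^ (p - 1) * x := by rw [← Real.rpow_add_one hx0.ne']; congr 1; ring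
    have e2 : x ^ (2 * p - 1) = x ^ (p - 1) * x ^ p := by
      rw [← Real.rpow_add hx0]; congr 1; ring
    have he' : (2 + a k) * (1 - x ^ p) = 2 * p * (1 - x) := by
      field_simp at he
      linarith
    have hxp1 : 0 < 1 - x ^ p := by
      have := Real.rpow_lt_one hx0.le hx1 (by linarith : 0 < p)
      linarith
    have h1 : x ^ (p - 1) * (2 + a k) ≤ 1 + x ^ (p - 1) := by
      rw [← mul_le_mul_iff_left₀ hxp1, mul_assoc, he']
      rw [e2] at key
      nlinarith
    have h2 : x ^ (p - 1) * a k ≤ a (k + 1) := by rw [ha]; linarith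
    rw [hδx, Real.mul_rpow hx0.le hδk.le]
    nlinarith

lemma tendsto_delta (hb : IsBubbleSeq p a δ) (hp : 1 ≤ p) : Tendsto δ atTop (nhds 0) := by
  have hbdd : BddBelow (Set.range δ) := ⟨0, by rintro _ ⟨k, rfl⟩; exact (hb.delta_pos k).le⟩
  have hlim := tendsto_atTop_ciInf hb.delta_strictAnti.antitone hbdd
  set d := ⨅ k, δ k
  have hd0 : 0 ≤ d := le_ciInf fun k => (hb.delta_pos k).le
  rcases hd0.eq_or_lt with h | hd
  · rwa [← h] at hlim
  exfalso
  have hx : Tendsto (fun k => δ (k + 1) / δ k) atTop (nhds 1) := by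
    have := (hlim.comp (tendsto_add_atTop_nat 1)).div hlim hd.ne'
    rwa [div_self hd.ne'] at this
  have hx' : Tendsto (fun k => 4 * (1 - (δ (k + 1) / δ k) ^ (p - 1))) atTop (nhds 0) := by
    have := ((hx.rpow_const (p := p - 1) (Or.inl one_ne_zero)).const_sub 1).const_mul 4
    simpa using this
  have hc : 0 < d ^ (p - 1) := Real.rpow_pos_of_pos hd _
  obtain ⟨k, hk⟩ := (hx'.eventually_lt_const hc).exists
  obtain ⟨hδ, -, ha, -⟩ := hb.2.2 k
  have h1 : d ^ (p - 1) ≤ δ k ^ (p - 1) :=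
    Real.rpow_le_rpow hd0 (ciInf_le hbdd k) (by linarith)
  have h2 := hb.two_mul_delta_rpow_le_a hp k
  have h3 := hb.a_pos (k + 1)
  have h4 := hb.a_le_two k
  have h5 : (δ (k + 1) / δ k) ^ (p - 1) ≤ 1 :=
    Real.rpow_le_one (div_pos hδ.1 (hb.delta_pos k)).le
      ((div_le_one (hb.delta_pos k)).2 hδ.2.le) (by linarith)
  nlinarith

end IsBubbleSeq

lemma log_rpow_div_rpow_tendsto {p : ℝ} (hp : 0 < p) {w : ℕ → ℝ} (hw : Tendsto w atTop atTop) :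
    Tendsto (fun n => Real.log (w n) / w n ^ p) atTop (nhds 0) :=
  ((isLittleO_log_rpow_atTop hp).tendsto_div_nhds_zero).comp hw

lemma tendsto_log_balance {p m c₀ τ₀ A : ℝ} {f : ℝ → ℝ} {lam r w : ℕ → ℝ} (hp : 0 < p)
    (hc₀ : 0 < c₀) (hf : ∀ t, τ₀ ≤ t → f t = c₀ * t ^ m * Real.exp (t ^ p)) (hA : 0 < A)
    (hlam : ∀ n, 0 < lam n) (hr : ∀ n, 0 < r n) (hw : Tendsto w atTop atTop)
    (hφ : Tendsto (fun n => p * lam n * r n ^ 2 * w n ^ (p - 1) * f (w n)) atTop (nhds A)) :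
    Tendsto (fun n => 2 * Real.log (1 / r n) - w n ^ p - Real.log (lam n)
      - (p - 1 + m) * Real.log (w n)) atTop (nhds (Real.log (p * c₀) - Real.log A)) := by
  refine ((hφ.log hA.ne').const_sub (Real.log (p * c₀))).congr' ?_
  filter_upwards [hw.eventually_ge_atTop τ₀, hw.eventually_gt_atTop 0] with n h1 h2
  have h3 := hlam n
  have h4 := hr n
  have h5 := Real.rpow_pos_of_pos h2 (p - 1)
  have h6 := Real.rpow_pos_of_pos h2 m
  have h7 := Real.exp_pos (w n ^ p)
  rw [hf _ h1, Real.log_mul (by positivity) (by positivity), Real.log_mul (by positivity)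
    (by positivity), Real.log_mul (by positivity) (by positivity), Real.log_mul (by positivity)
    (by positivity), Real.log_mul (by positivity) (by positivity), Real.log_mul (by positivity)
    (by positivity), Real.log_mul (by positivity) (by positivity), Real.log_exp,
    Real.log_rpow h2, Real.log_rpow h2, Real.log_pow, one_div, Real.log_inv]
  push_cast
  ring

lemma tendsto_log_div_rpow_zero {p m lamstar : ℝ} {δ : ℕ → ℝ} {lam μ : ℕ → ℝ} {w T : ℕ → ℕ → ℝ}
    {R : ℕ → ℝ} (hp : 0 < p) (hδ0 : Tendsto δ atTop (nhds 0))
    (hlam : ∀ n, 0 < lam n) (hconv : Tendsto lam atTop (nhds lamstar))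
    (hμ : Tendsto μ atTop atTop) (hw : ∀ k, Tendsto (w k) atTop atTop)
    (hwμ : ∀ k, Tendsto (fun n => w k n / μ n) atTop (nhds (δ k)))
    (hT : ∀ k n, 0 < T k n)
    (hbal : ∀ k, Tendsto (fun n => T k n - w k n ^ p - Real.log (lam n)
      - (p - 1 + m) * Real.log (w k n)) atTop (nhds (R k))) :
    Tendsto (fun n => Real.log (lam n) / μ n ^ p) atTop (nhds 0) := by
  have hμp : Tendsto (fun n => μ n ^ p) atTop atTop := (tendsto_rpow_atTop hp).comp hμ
  refine tendsto_order.2 ⟨fun η hη => ?_, fun η hη => ?_⟩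
  · have hδp : Tendsto (fun k => δ k ^ p) atTop (nhds 0) := by
      have := hδ0.rpow_const (p := p) (Or.inr hp.le)
      rwa [Real.zero_rpow hp.ne'] at this
    obtain ⟨j, hj⟩ := (hδp.eventually_lt_const (neg_pos.2 hη)).exists
    have h1 : Tendsto (fun n => (w j n / μ n) ^ p * (1 + (p - 1 + m) *
        (Real.log (w j n) / w j n ^ p)) + (T j n - w j n ^ p - Real.log (lam n)
      - (p - 1 + m) * Real.log (w j n)) / μ n ^ p) atTop (nhds (δ j ^ p)) := by
      have h2 := (((log_rpow_div_rpow_tendsto hp (hw j)).const_mul (p - 1 + m)).const_add 1)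
      have := (((hwμ j).rpow_const (p := p) (Or.inr hp.le)).mul h2).add ((hbal j).div_atTop hμp)
      simpa using this
    filter_upwards [h1.eventually_lt_const hj, hμ.eventually_gt_atTop 0,
      (hw j).eventually_gt_atTop 0] with n hn hμn hwn
    have e1 := Real.rpow_pos_of_pos hμn p
    have e2 := Real.rpow_pos_of_pos hwn p
    rw [Real.div_rpow hwn.le hμn.le] at hn
    have h3 : (T j n - Real.log (lam n)) / μ n ^ p < -η := by
      refine lt_of_eq_of_lt ?_ hn
      field_simp
      ring
    rw [div_lt_iff₀ e1] at h3
    rw [lt_div_iff₀ e1]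
    linarith [hT j n]
  · have h1 : Tendsto (fun n => Real.log (lamstar + 1) / μ n ^ p) atTop (nhds 0) :=
      tendsto_const_nhds.div_atTop hμp
    filter_upwards [h1.eventually_lt_const hη, hμp.eventually_gt_atTop 0,
      hconv.eventually_lt_const (lt_add_one lamstar)] with n hn hμn hln
    refine lt_of_le_of_lt ?_ hn
    gcongr
    exact hlam n

lemma tendsto_div_rpow_one {p m d R : ℝ} {lam μ w T : ℕ → ℝ} (hp : 0 < p) (hd : 0 < d)
    (hμ : Tendsto μ atTop atTop) (hw : Tendsto w atTop atTop)
    (hwμ : Tendsto (fun n => w n / μ n) atTop (nhds d))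
    (hlam : Tendsto (fun n => Real.log (lam n) / μ n ^ p) atTop (nhds 0))
    (hbal : Tendsto (fun n => T n - w n ^ p - Real.log (lam n)
      - (p - 1 + m) * Real.log (w n)) atTop (nhds R)) :
    Tendsto (fun n => T n / w n ^ p) atTop (nhds 1) := by
  have hwp : Tendsto (fun n => w n ^ p) atTop atTop := (tendsto_rpow_atTop hp).comp hw
  have h1 := hlam.div (hwμ.rpow_const (p := p) (Or.inr hp.le)) (Real.rpow_pos_of_pos hd p).ne'
  have h2 := (log_rpow_div_rpow_tendsto hp hw).const_mul (p - 1 + m)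
  have h3 := ((h1.add h2).add (hbal.div_atTop hwp)).const_add 1
  rw [zero_div, mul_zero, add_zero, add_zero, add_zero] at h3
  refine h3.congr' ?_
  filter_upwards [hμ.eventually_gt_atTop 0, hw.eventually_gt_atTop 0] with n hμn hwn
  have e1 := Real.rpow_pos_of_pos hμn p
  have e2 := Real.rpow_pos_of_pos hwn p
  simp only [Pi.div_apply]
  rw [Real.div_rpow hwn.le hμn.le]
  field_simp
  ring

/-- At the bubble centers the solution eventually lies above `V_L`. -/
lemma eventually_Vfun_lt {p m L : ℝ} {lam r w : ℕ → ℝ} (hp : 0 < p)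
    (hw : Tendsto w atTop atTop)
    (hratio : Tendsto (fun n => 2 * Real.log (1 / r n) / w n ^ p) atTop (nhds 1))
    (hL : ∀ᶠ n in atTop, L < -(2 * Real.log (1 / r n) - w n ^ p - Real.log (lam n)
      - (p - 1 + m) * Real.log (w n)) - Real.log (lam n)
      + (1 - (1 - m) / p) * Real.log (2 * Real.log (1 / r n) / w n ^ p)) :
    ∀ᶠ n in atTop, Vfun p m L (r n) < w n := by
  have hwp : Tendsto (fun n => w n ^ p) atTop atTop := (tendsto_rpow_atTop hp).comp hw
  have hT : Tendsto (fun n => 2 * Real.log (1 / r n)) atTop atTop := by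
    refine (hratio.pos_mul_atTop one_pos hwp).congr' ?_
    filter_upwards [hwp.eventually_gt_atTop 0] with n hn
    field_simp
  have hbase : Tendsto (fun x : ℝ => x - (1 - (1 - m) / p) * Real.log x) atTop atTop := by
    have h1 : Tendsto (fun x : ℝ => 1 - (1 - (1 - m) / p) * (Real.log x / x)) atTop (nhds 1) := by
      have := (Real.isLittleO_log_id_atTop.tendsto_div_nhds_zero.const_mul
        (1 - (1 - m) / p)).const_sub 1
      simpa using this
    refine (h1.pos_mul_atTop one_pos tendsto_id).congr' ?_
    filter_upwards [eventually_gt_atTop 0] with x hx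
    simp only [id]
    field_simp
  filter_upwards [hL, hw.eventually_gt_atTop 0, hT.eventually_gt_atTop 0,
    (hbase.comp hT).eventually_ge_atTop (-L)] with n h1 h2 h3 h4
  simp only [Function.comp] at h4
  have e2 := Real.rpow_pos_of_pos h2 p
  rw [Real.log_div h3.ne' e2.ne', Real.log_rpow h2] at h1
  have e3 : (1 - (1 - m) / p) * (p * Real.log (w n)) = (p - 1 + m) * Real.log (w n) := by
    field_simp
    ring
  rw [Vfun, one_div p, Real.rpow_inv_lt_iff_of_pos (by linarith) h2.le hp]
  linarith

lemma exists_seq_of_eventually_exists {α : Type*} [Nonempty α] {P : ℕ → α → Prop}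
    {g : ℕ → α → ℝ} (H : ∀ ρ > 0, ∀ᶠ n in atTop, ∃ x, P n x ∧ |g n x| ≤ ρ) :
    ∃ x : ℕ → α, (∀ᶠ n in atTop, P n (x n)) ∧ Tendsto (fun n => g n (x n)) atTop (nhds 0) := by
  have key : ∀ n, ∃ x, (∃ y, P n y) →
      P n x ∧ ∀ y, P n y → |g n x| ≤ |g n y| + 1 / ((n : ℝ) + 1) := by
    intro n
    by_cases h : ∃ y, P n y
    · let S := (fun y => |g n y|) '' {y | P n y}
      have hS : S.Nonempty := h.elim fun y hy => ⟨_, y, hy, rfl⟩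
      have hS0 : BddBelow S := ⟨0, by rintro _ ⟨y, -, rfl⟩; exact abs_nonneg _⟩
      obtain ⟨_, ⟨x, hx, rfl⟩, hlt⟩ :=
        exists_lt_of_csInf_lt hS (lt_add_of_pos_right (sInf S) (Nat.one_div_pos_of_nat (n := n)))
      exact ⟨x, fun _ => ⟨hx, fun y hy => hlt.le.trans
        (add_le_add_left (csInf_le hS0 ⟨y, hy, rfl⟩) _)⟩⟩
    · exact ⟨Classical.arbitrary α, fun h' => absurd h' h⟩
  choose x hx using key
  refine ⟨x, (H 1 one_pos).mono fun n ⟨y, hy, _⟩ => (hx n ⟨y, hy⟩).1, ?_⟩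
  refine Metric.tendsto_atTop'.2 fun η hη => ?_
  have h1 := (tendsto_one_div_add_atTop_nhds_zero_nat (𝕜 := ℝ)).eventually_lt_const (half_pos hη)
  obtain ⟨N, hN⟩ := eventually_atTop.1 ((H (η / 2) (half_pos hη)).and h1)
  refine ⟨N, fun n hn => ?_⟩
  obtain ⟨⟨y, hy, hgy⟩, h2⟩ := hN n hn.le
  rw [Real.dist_0_eq_abs]
  linarith [(hx n ⟨y, hy⟩).2 y hy]

/-- Near a bubble center, on either side (`e = ±1` in the variable `t = log (1 / r)`), the solutions
cross `U`. -/
lemma eventually_exists_crossing {p m c₀ τ₀ A : ℝ} {f U : ℝ → ℝ} {lam t : ℕ → ℝ}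
    {w w1 : ℕ → ℝ → ℝ} (hp : 1 ≤ p) (hc₀ : 0 < c₀) (hτ₀ : 0 < τ₀)
    (hf : ∀ x, τ₀ ≤ x → f x = c₀ * x ^ m * Real.exp (x ^ p))
    (hlam : ∀ n, 0 < lam n)
    (hconc : ∀ n, ConcaveOn ℝ (Set.Ici 0) (w n)) (hpos : ∀ n t, 0 ≤ t → 0 ≤ w n t)
    (hw : ∀ n t, 0 < t → HasDerivAt (w n) (w1 n t) t)
    (hw1 : ∀ n t, 0 < t → HasDerivAt (w1 n) (-(lam n * Real.exp (-2 * t) * f (w n t))) t)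
    (hwt : Tendsto (fun n => w n (t n)) atTop atTop)
    (hratio : Tendsto (fun n => 2 * t n / w n (t n) ^ p) atTop (nhds 1))
    (hA : 0 < A)
    (hφ : Tendsto (fun n => p * lam n * Real.exp (-2 * t n) * w n (t n) ^ (p - 1) * f (w n (t n)))
      atTop (nhds A))
    {r₁ : ℝ} (hr₁ : 0 < r₁) (hUcont : ContinuousOn U (Set.Ioo 0 r₁))
    (hUlow : ∀ ε ∈ Set.Ioo (0:ℝ) 2, ∃ r₀ > 0, ∀ r ∈ Set.Ioo (0:ℝ) r₀, Ubeta p (2 - ε) r ≤ U r)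
    (hUlt : ∀ᶠ n in atTop, U (Real.exp (-t n)) < w n (t n))
    {e : ℝ} (he : e = 1 ∨ e = -1) {ρ : ℝ} (hρ : 0 < ρ) :
    ∀ᶠ n in atTop, ∃ s, 0 < s ∧ 0 < e * (s - t n) ∧ w n s = U (Real.exp (-s)) ∧
      |w n s - w n (t n)| ≤ ρ * w n (t n) := by
  have hp0 : 0 < p := by linarith
  have heabs : |e| = 1 := by rcases he with rfl | rfl <;> norm_num
  have he2 : e * e = 1 := by rcases he with rfl | rfl <;> norm_num
  have he1 : -1 ≤ e ∧ e ≤ 1 := by rcases he with rfl | rfl <;> norm_num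
  obtain ⟨K, hK1, hcK⟩ : ∃ K : ℝ, 1 ≤ K ∧ 48 * 2 ^ |m| ≤ A / 2 * K ^ 2 := by
    have h2m : (0:ℝ) < 2 ^ |m| := Real.rpow_pos_of_pos (by norm_num) _
    refine ⟨1 + 96 * 2 ^ |m| / A, by
      have : 0 < 96 * 2 ^ |m| / A := by positivity
      linarith, ?_⟩
    have h1 : 0 < 96 * 2 ^ |m| / A := by positivity
    have h2 : 1 + 96 * 2 ^ |m| / A ≤ (1 + 96 * 2 ^ |m| / A) ^ 2 := by nlinarith
    have h3 : A / 2 * (96 * 2 ^ |m| / A) = 48 * 2 ^ |m| := by field_simp; norm_num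
    nlinarith
  have hK0 : 0 < K := by linarith
  have hKinv : 0 < 1 / K ∧ 1 / K ≤ 1 := ⟨by positivity, (div_le_one hK0).2 hK1⟩
  obtain ⟨σ, hσ0, hσρ, hσK⟩ : ∃ σ : ℝ, 0 < σ ∧ σ ≤ ρ / 4 ∧ 10 * σ ≤ 1 / K :=
    ⟨min (ρ / 4) (1 / K / 10), by
      have := hKinv.1
      positivity, min_le_left _ _, by linarith [min_le_right (ρ / 4) (1 / K / 10)]⟩
  set y := (2 * e - 1 / K) * σ with hy
  have hy3 : |y| ≤ 3 * σ := by
    rw [hy, abs_mul, abs_of_pos hσ0]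
    refine mul_le_mul_of_nonneg_right ?_ hσ0.le
    rw [abs_le]; constructor <;> linarith [hKinv.1, hKinv.2, he1.1, he1.2]
  have hB : Real.exp y < 1 + 2 * e * σ := by
    have h1 := (abs_le.1 (Real.abs_exp_sub_one_sub_id_le (x := y) (by linarith [hKinv.2]))).2
    have h2 : y ^ 2 ≤ (3 * σ) ^ 2 := sq_le_sq' (by linarith [neg_abs_le y]) ((le_abs_self y).trans hy3)
    have h3 : (3 * σ) ^ 2 < 1 / K * σ := by nlinarith
    have h4 : y = 2 * e * σ - 1 / K * σ := by rw [hy]; ring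
    linarith
  have hexp := Real.exp_pos y
  set B := 1 + 2 * e * σ with hBdef
  have hB0 : 0 < B := hexp.trans hB
  set ε := 1 - Real.exp y / B with hε
  have hε01 : 0 < ε ∧ ε < 1 := by
    have h1 : Real.exp y / B < 1 := (div_lt_one hB0).2 hB
    have h2 : 0 < Real.exp y / B := by positivity
    constructor <;> linarith
  have hεB : Real.exp y < (1 - ε / 2) * B := by
    have : (1 - ε / 2) * B = (B + Real.exp y) / 2 := by rw [hε]; field_simp; ring
    linarith
  obtain ⟨r₀, hr₀, hUr₀⟩ := hUlow ε ⟨hε01.1, by linarith⟩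
  have hlim1 : Tendsto (fun n => (1 - ε / 2) * (2 * t n / w n (t n) ^ p + 2 * e * σ)) atTop
      (nhds ((1 - ε / 2) * B)) := (hratio.add_const (2 * e * σ)).const_mul _
  have hwp : Tendsto (fun n => w n (t n) ^ p) atTop atTop := (tendsto_rpow_atTop hp0).comp hwt
  have hrmin : 0 < min r₀ r₁ := lt_min hr₀ hr₁
  filter_upwards [hlim1.eventually_const_lt hεB, hwt.eventually_ge_atTop (2 * τ₀),
    hUlt, hφ.eventually_const_lt (half_lt_self hA), hwp.eventually_ge_atTop (K / σ),
    hwp.eventually_ge_atTop (10 * K), hwp.eventually_gt_atTop (-Real.log (min r₀ r₁) / (1 / 4)),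
    hratio.eventually_const_lt (by norm_num : (9 / 10 : ℝ) < 1)]
    with n h1 h2 h3 h4 h5 h6 h7 h8
  set v := w n (t n) with hv
  set X := v ^ p with hX
  have hv0 : 0 < v := by linarith
  have hX0 : 0 < X := Real.rpow_pos_of_pos hv0 p
  rw [div_le_iff₀ hσ0] at h5
  rw [lt_div_iff₀ hX0] at h8
  rw [div_lt_iff₀ (by norm_num)] at h7
  have ht0 : 0 < t n := by linarith
  have hσX : σ * X ≤ 1 / 10 * X := by
    refine mul_le_mul_of_nonneg_right ?_ hX0.le
    linarith [hKinv.2]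
  have hσX0 : 0 < σ * X := by positivity
  set t' := t n + e * (σ * X) with ht'
  have hbetween : ∀ s ∈ Set.uIcc (t n) t', X / 4 < s ∧ |s - t n| ≤ σ * X := by
    intro s hs
    have hs' : |s - t n| ≤ σ * X := by
      refine (Set.abs_sub_left_of_mem_uIcc hs).trans_eq ?_
      rw [ht', add_sub_cancel_left, abs_mul, heabs, one_mul, abs_of_pos hσX0]
    exact ⟨by linarith [neg_abs_le (s - t n)], hs'⟩
  have hsmall : ∀ s ∈ Set.uIcc (t n) t', Real.exp (-s) < min r₀ r₁ := by
    intro s hs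
    rw [← Real.lt_log_iff_exp_lt hrmin]
    linarith [(hbetween s hs).1]
  have ht'mem : t' ∈ Set.uIcc (t n) t' := Set.right_mem_uIcc
  have ht'0 : 0 < t' := by linarith [(hbetween t' ht'mem).1]
  have hbend := (hconc n).le_add_of_bubble hp hc₀ hτ₀ (hlam n) hf (hpos n) (hw n) (hw1 n)
    (t := t n) (K := K) (e := e) (s := σ * X) hK0 he (by linarith) h2
    (hcK.trans (mul_le_mul_of_nonneg_right h4.le (sq_nonneg K))) (by linarith) ht'0.le
  rw [← ht', ← hv] at hbend
  have hXv : X = v ^ (p - 1) * v := by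
    rw [← Real.rpow_add_one hv0.ne', hX]; congr 1; ring
  have hwt' : w n t' ≤ v * (1 + y / p) := by
    have h9 := Real.rpow_pos_of_pos hv0 (p - 1)
    have h10 : p * v ^ (p - 1) * (w n t' - v) ≤ p * v ^ (p - 1) * (y * v / p) := by
      refine hbend.trans_eq ?_
      rw [hy, hXv]; field_simp
    have := le_of_mul_le_mul_left h10 (by positivity)
    calc w n t' ≤ v + y * v / p := by linarith
      _ = v * (1 + y / p) := by ring
  have hpow : w n t' ^ p ≤ X * Real.exp y := by
    calc w n t' ^ p ≤ (v * Real.exp (y / p)) ^ p := by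
          refine Real.rpow_le_rpow (hpos n _ ht'0.le) (hwt'.trans ?_) hp0.le
          gcongr
          linarith [Real.add_one_le_exp (y / p)]
      _ = X * Real.exp y := by
          rw [Real.mul_rpow hv0.le (Real.exp_pos _).le, ← Real.exp_mul,
            div_mul_cancel₀ _ hp0.ne']
  have hless : w n t' < U (Real.exp (-t')) := by
    refine lt_of_lt_of_le ?_ (hUr₀ _ ⟨Real.exp_pos _, (hsmall t' ht'mem).trans_le (min_le_left _ _)⟩)
    rw [Ubeta, one_div (Real.exp _), ← Real.exp_neg, neg_neg, Real.log_exp, one_div p,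
      Real.lt_rpow_inv_iff_of_pos (hpos n _ ht'0.le)
        (mul_nonneg (by linarith [hε01.2]) ht'0.le) hp0]
    refine hpow.trans_lt ?_
    calc X * Real.exp y < X * ((1 - ε / 2) * (2 * t n / X + 2 * e * σ)) := by gcongr
      _ = (2 - ε) * t' := by rw [ht']; field_simp
  have hcont : ContinuousOn (fun s => w n s - U (Real.exp (-s))) (Set.uIcc (t n) t') := by
    refine ContinuousOn.sub (fun s hs => ?_) (hUcont.comp (by fun_prop) fun s hs => ?_)
    · exact (hw n s (by linarith [(hbetween s hs).1])).continuousAt.continuousWithinAt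
    · exact ⟨Real.exp_pos _, (hsmall s hs).trans_le (min_le_right _ _)⟩
  obtain ⟨s, hs, hs0⟩ := intermediate_value_uIcc hcont
    (Set.mem_uIcc_of_ge (by linarith) (by linarith) :
      (0:ℝ) ∈ Set.uIcc (w n (t n) - U (Real.exp (-t n))) (w n t' - U (Real.exp (-t'))))
  have hs0' : w n s = U (Real.exp (-s)) := sub_eq_zero.1 hs0
  have hspos : 0 < s := by linarith [(hbetween s hs).1]
  refine ⟨s, hspos, ?_, hs0', ?_⟩
  · have hne : s ≠ t n := by
      rintro rfl
      exact h3.ne' hs0'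
    have hge : 0 ≤ e * (s - t n) := by
      rcases he with rfl | rfl
      · rw [Set.uIcc_of_le (by linarith)] at hs
        linarith [hs.1]
      · rw [Set.uIcc_of_ge (by linarith)] at hs
        linarith [hs.2]
    refine lt_of_le_of_ne hge fun h => ?_
    rcases mul_eq_zero.1 h.symm with h | h
    · rw [h] at he2; norm_num at he2
    · exact hne (sub_eq_zero.1 h)
  · have hab := (hconc n).abs_sub_mul_le (hpos n) hspos.le ht0.le
    rw [← hv] at hab
    have h9 : v * |s - t n| ≤ v * (σ * X) := by
      have := (hbetween s hs).2
      gcongr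
    have h10 : σ * X ≤ ρ * t n := by
      calc σ * X ≤ ρ / 4 * X := by gcongr
        _ = ρ * (X / 4) := by ring
        _ ≤ ρ * t n := by gcongr; linarith
    have h11 : |w n s - v| * t n ≤ ρ * v * t n := by
      calc |w n s - v| * t n ≤ v * (σ * X) := hab.trans h9
        _ ≤ v * (ρ * t n) := by gcongr
        _ = ρ * v * t n := by ring
    exact le_of_mul_le_mul_right h11 ht0

/-- Zeros of `v` collected from pairs of zeros near well-separated levels of a function `u`. -/
lemma zeroCountAtLeast_of_levels {u v : ℝ → ℝ} {x y d : ℕ → ℝ}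
    (hu : ∀ s ∈ Set.Ioo (0:ℝ) 1, ∀ t ∈ Set.Ioo (0:ℝ) 1, u s < u t → t < s) (k : ℕ)
    (hx : ∀ j, x j ∈ Set.Ioo (0:ℝ) 1) (hy : ∀ j, y j ∈ Set.Ioo (0:ℝ) 1)
    (hxy : ∀ j ≤ k, x j < y j) (hvx : ∀ j ≤ k, v (x j) = 0) (hvy : ∀ j ≤ k, v (y j) = 0)
    (hxd : ∀ j < k, u (x (j + 1)) < d j) (hyd : ∀ j < k, d j < u (y j)) :
    ZeroCountAtLeast (Set.Ioc 0 (y k)) v (2 * (k + 1)) := by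
  induction k with
  | zero =>
    refine ⟨{x 0, y 0}, ?_, by rw [Finset.card_pair (hxy 0 le_rfl).ne]⟩
    intro z hz
    simp only [Finset.coe_insert, Finset.coe_singleton, Set.mem_insert_iff,
      Set.mem_singleton_iff] at hz
    rcases hz with rfl | rfl
    · exact ⟨⟨(hx 0).1, (hxy 0 le_rfl).le⟩, hvx 0 le_rfl⟩
    · exact ⟨⟨(hy 0).1, le_rfl⟩, hvy 0 le_rfl⟩
  | succ k ih =>
    obtain ⟨S, hS, hcard⟩ := ih (fun j hj => hxy j (by omega)) (fun j hj => hvx j (by omega))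
      (fun j hj => hvy j (by omega)) (fun j hj => hxd j (by omega)) (fun j hj => hyd j (by omega))
    have h1 : y k < x (k + 1) := hu _ (hx _) _ (hy _)
      ((hxd k (by omega)).trans (hyd k (by omega)))
    have h2 := hxy (k + 1) le_rfl
    have hxS : x (k + 1) ∉ S := fun h => absurd (hS h).1.2 (by linarith)
    have hyS : y (k + 1) ∉ insert (x (k + 1)) S := by
      rw [Finset.mem_insert]
      rintro (h | h)
      · linarith
      · exact absurd (hS h).1.2 (by linarith)
    refine ⟨insert (y (k + 1)) (insert (x (k + 1)) S), ?_, by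
      rw [Finset.card_insert_of_notMem hyS, Finset.card_insert_of_notMem hxS]; omega⟩
    intro z hz
    simp only [Finset.coe_insert, Set.mem_insert_iff, Finset.mem_coe] at hz
    rcases hz with rfl | rfl | hz
    · exact ⟨⟨(hy _).1, le_rfl⟩, hvy _ le_rfl⟩
    · exact ⟨⟨(hx _).1, h2.le⟩, hvx _ le_rfl⟩
    · exact ⟨⟨(hS hz).1.1, (hS hz).1.2.trans (by linarith)⟩, (hS hz).2⟩

/-- Corollary 5.7 of the paper, intersection numbers in the
supercritical case `p > 2` under (H3). -/
theorem statement16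
    (p : ℝ) (hp : 2 < p)
    (h : ℝ → ℝ)
    (hhC1 : ContDiffOn ℝ 1 h (Set.Ici 0))
    (hhnonneg : ∀ t : ℝ, 0 ≤ t → 0 ≤ h t)
    (t₀' : ℝ) (ht₀' : 0 < t₀') (hhpos : ∀ t : ℝ, t₀' ≤ t → 0 < h t)
    (f : ℝ → ℝ) (hf : ∀ t : ℝ, f t = h t * Real.exp (t ^ p))
    -- (H3)
    (c₀ τ₀ m : ℝ) (hc₀ : 0 < c₀) (hτ₀ : 0 < τ₀)
    (hH3 : ∀ t : ℝ, τ₀ ≤ t → f t = c₀ * t ^ m * Real.exp (t ^ p))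
    (lam μ : ℕ → ℝ) (u : ℕ → ℝ → ℝ)
    (hlam : ∀ n, 0 < lam n) (hμ : ∀ n, 0 < μ n)
    (huC2 : ∀ n, ContDiffOn ℝ 2 (u n) (Set.Icc 0 1))
    (hupos : ∀ n, ∀ r ∈ Set.Ico (0:ℝ) 1, 0 < u n r)
    (hu0 : ∀ n, u n 0 = μ n)
    (hu'0 : ∀ n, deriv (u n) 0 = 0)
    (hu1 : ∀ n, u n 1 = 0)
    (heq : ∀ n, ∀ r ∈ Set.Ioo (0:ℝ) 1,
      -(deriv (deriv (u n)) r) - deriv (u n) r / r = lam n * f (u n r))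
    (hmuInf : Tendsto μ atTop atTop)
    (lamstar : ℝ) (hlamstar : 0 ≤ lamstar)
    (hconv : Tendsto lam atTop (nhds lamstar))
    -- the bubble sequences and concentration centers (r_{k,n}) from Theorem 1.4
    (a δ : ℕ → ℝ) (hb : IsBubbleSeq p a δ)
    (rk : ℕ → ℕ → ℝ)
    (hrkmem : ∀ k n, rk k n ∈ Set.Ioo (0:ℝ) 1)
    (hrku : ∀ k, Tendsto (fun n => u n (rk k n) / μ n) atTop (nhds (δ k)))
    (hrkphi : ∀ k, Tendsto (fun n =>
        p * lam n * (rk k n) ^ 2 * (u n (rk k n)) ^ (p - 1) * f (u n (rk k n)))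
      atTop (nhds ((a k) ^ 2 / 2)))
    -- the continuous comparison function U and the sandwich hypotheses (i)/(ii)
    (U : ℝ → ℝ) (r₁ : ℝ) (hr₁ : 0 < r₁) (hUcont : ContinuousOn U (Set.Ioo 0 r₁))
    (hU : (lamstar ≠ 0 ∧
            ∀ ε ∈ Set.Ioo (0:ℝ) 2, ∀ L : ℝ, ∃ r₀ ∈ Set.Ioo (0:ℝ) 1,
              ∀ r ∈ Set.Ioo (0:ℝ) r₀,
                Ubeta p (2 - ε) r ≤ U r ∧ U r ≤ Vfun p m L r) ∨
          (lamstar = 0 ∧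
            ∀ ε : ℝ, 0 < ε → ∃ r₀ ∈ Set.Ioo (0:ℝ) 1, ∃ L : ℝ,
              ∀ r ∈ Set.Ioo (0:ℝ) r₀,
                Ubeta p (2 - ε) r ≤ U r ∧ U r ≤ Vfun p m L r)) :
    ∃ φ : ℕ → ℕ, StrictMono φ ∧
      (∀ k : ℕ, ∃ rm rp : ℕ → ℝ,
        (∀ n, rm n ∈ Set.Ioo (0:ℝ) 1) ∧
        (∀ n, rp n ∈ Set.Ioo (0:ℝ) 1) ∧
        Tendsto (fun n => u (φ n) (rm n) / μ (φ n)) atTop (nhds (δ k)) ∧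
        Tendsto (fun n => u (φ n) (rp n) / μ (φ n)) atTop (nhds (δ k)) ∧
        (∀ᶠ n in atTop,
          rm n < rk k (φ n) ∧ rk k (φ n) < rp n ∧
          u (φ n) (rm n) = U (rm n) ∧ u (φ n) (rp n) = U (rp n)) ∧
        (∀ᶠ n in atTop,
          ZeroCountAtLeast (Set.Ioc 0 (rp n))
            (fun x => u (φ n) x - U x) (2 * (k + 1)))) ∧
      (∀ r : ℕ → ℝ, (∀ n, r n ∈ Set.Ioo (0:ℝ) 1) →
        Tendsto (fun n => u (φ n) (r n) / μ (φ n)) atTop (nhds 0) →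
        ∀ N : ℕ, ∀ᶠ n in atTop,
          ZeroCountAtLeast (Set.Ioo 0 (r n)) (fun x => u (φ n) x - U x) N) := by
  have hp0 : 0 < p := by linarith
  have hp1 : 1 ≤ p := by linarith
  have hfpos : ∀ x, 0 ≤ x → 0 ≤ f x := fun x hx => by
    rw [hf]
    exact mul_nonneg (hhnonneg x hx) (Real.exp_pos _).le
  have hexpmem : ∀ t : ℝ, 0 < t → Real.exp (-t) ∈ Set.Ioo (0:ℝ) 1 := fun t ht =>
    ⟨Real.exp_pos _, Real.exp_lt_one_iff.2 (by linarith)⟩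
  have hlog := fun n => radial_solution_log_coordinates (hlam n) hfpos (huC2 n) (hupos n) (heq n)
  have hwpos : ∀ n t, 0 ≤ t → 0 ≤ u n (Real.exp (-t)) := fun n t ht => by
    rcases ht.eq_or_lt with rfl | ht
    · simp [hu1 n]
    · exact (hupos n _ ⟨(hexpmem t ht).1.le, (hexpmem t ht).2⟩).le
  have hexplog : ∀ r : ℝ, 0 < r → Real.exp (-Real.log (1 / r)) = r := fun r hr => by
    rw [one_div, Real.log_inv, neg_neg, Real.exp_log hr]
  have hlogpos : ∀ r ∈ Set.Ioo (0:ℝ) 1, 0 < Real.log (1 / r) := fun r hr =>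
    Real.log_pos (by rw [one_div]; exact (one_lt_inv₀ hr.1).2 hr.2)
  have hanti : ∀ n, ∀ s ∈ Set.Ioo (0:ℝ) 1, ∀ t ∈ Set.Ioo (0:ℝ) 1, u n s < u n t → t < s := by
    intro n s hs t ht hst
    by_contra! hle
    have h1 := (hlog n).2.2.monotoneOn_of_nonneg (hwpos n) (hlogpos t ht).le (hlogpos s hs).le
      (Real.log_le_log (one_div_pos.2 ht.1) (one_div_le_one_div_of_le hs.1 hle))
    simp only [hexplog t ht.1, hexplog s hs.1] at h1
    linarith
  have hwk : ∀ k, Tendsto (fun n => u n (rk k n)) atTop atTop := fun k => by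
    refine ((hrku k).pos_mul_atTop (hb.delta_pos k) hmuInf).congr fun n => ?_
    exact div_mul_cancel₀ _ (hμ n).ne'
  have hApos : ∀ k, 0 < a k ^ 2 / 2 := fun k => by
    have := hb.a_pos k
    positivity
  have hbal := fun k => tendsto_log_balance (r := rk k) hp0 hc₀ hH3 (hApos k) hlam
    (fun n => (hrkmem k n).1) (hwk k) (hrkphi k)
  have hlamlog := tendsto_log_div_rpow_zero hp0 (hb.tendsto_delta hp1) hlam hconv hmuInf hwk hrku
    (fun k n => mul_pos two_pos (hlogpos _ (hrkmem k n))) hbal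
  have hratio := fun k => tendsto_div_rpow_one hp0 (hb.delta_pos k) hmuInf (hwk k) (hrku k)
    hlamlog (hbal k)
  have hlogratio : ∀ k, Tendsto (fun n => (1 - (1 - m) / p) *
      Real.log (2 * Real.log (1 / rk k n) / u n (rk k n) ^ p)) atTop (nhds 0) := fun k => by
    simpa using ((hratio k).log one_ne_zero).const_mul (1 - (1 - m) / p)
  have hUlow : ∀ ε ∈ Set.Ioo (0:ℝ) 2, ∃ r₀ > 0, ∀ r ∈ Set.Ioo (0:ℝ) r₀,
      Ubeta p (2 - ε) r ≤ U r := by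
    intro ε hε
    rcases hU with ⟨-, hU⟩ | ⟨-, hU⟩
    · obtain ⟨r₀, hr₀, h⟩ := hU ε hε 0
      exact ⟨r₀, hr₀.1, fun r hr => (h r hr).1⟩
    · obtain ⟨r₀, hr₀, L, h⟩ := hU ε hε.1
      exact ⟨r₀, hr₀.1, fun r hr => (h r hr).1⟩
  have hrk0 : ∀ k, Tendsto (rk k) atTop (nhds 0) := fun k => by
    have h1 : Tendsto (fun n => Real.log (1 / rk k n)) atTop atTop := by
      have h2 := ((hratio k).pos_mul_atTop one_pos
        ((tendsto_rpow_atTop hp0).comp (hwk k))).const_mul_atTop (half_pos one_pos)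
      refine h2.congr' ?_
      filter_upwards [(hwk k).eventually_gt_atTop 0] with n hn
      have := Real.rpow_pos_of_pos hn p
      simp only [Function.comp]
      field_simp
    exact (Real.tendsto_exp_neg_atTop_nhds_zero.comp h1).congr fun n => hexplog _ (hrkmem k n).1
  have hUlt : ∀ k, ∀ᶠ n in atTop, U (rk k n) < u n (rk k n) := by
    intro k
    obtain ⟨L, r₀, hr₀, hUV, hL⟩ : ∃ L r₀ : ℝ, 0 < r₀ ∧ (∀ r ∈ Set.Ioo 0 r₀, U r ≤ Vfun p m L r) ∧
        ∀ᶠ n in atTop, L < -(2 * Real.log (1 / rk k n) - u n (rk k n) ^ p - Real.log (lam n)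
          - (p - 1 + m) * Real.log (u n (rk k n))) - Real.log (lam n)
          + (1 - (1 - m) / p) * Real.log (2 * Real.log (1 / rk k n) / u n (rk k n) ^ p) := by
      rcases hU with ⟨hne, hU⟩ | ⟨h0, hU⟩
      · have hlim := ((hbal k).neg.sub (hconv.log hne)).add (hlogratio k)
        obtain ⟨r₀, hr₀, h⟩ := hU 1 ⟨one_pos, one_lt_two⟩ _
        exact ⟨_, r₀, hr₀.1, fun r hr => (h r hr).2, hlim.eventually_const_lt (sub_one_lt _)⟩
      · obtain ⟨r₀, hr₀, L, h⟩ := hU 1 one_pos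
        refine ⟨L, r₀, hr₀.1, fun r hr => (h r hr).2, ?_⟩
        have hlamlog0 : Tendsto (fun n => -Real.log (lam n)) atTop atTop := by
          refine tendsto_neg_atBot_atTop.comp (Real.tendsto_log_nhdsGT_zero.comp ?_)
          exact tendsto_nhdsWithin_iff.2 ⟨h0 ▸ hconv, Eventually.of_forall hlam⟩
        exact (((hbal k).neg.add_atTop hlamlog0).atTop_add (hlogratio k)).eventually_gt_atTop L
    filter_upwards [eventually_Vfun_lt hp0 (hwk k) (hratio k) hL,
      (hrk0 k).eventually_lt_const hr₀] with n h1 h2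
    exact (hUV _ ⟨(hrkmem k n).1, h2⟩).trans_lt h1
  have hcross : ∀ k, ∀ e : ℝ, (e = 1 ∨ e = -1) → ∃ r : ℕ → ℝ, (∀ n, r n ∈ Set.Ioo (0:ℝ) 1) ∧
      Tendsto (fun n => u n (r n) / μ n) atTop (nhds (δ k)) ∧
      ∀ᶠ n in atTop, 0 < e * (rk k n - r n) ∧ u n (r n) = U (r n) := by
    intro k e he
    have : Nonempty (Set.Ioo (0:ℝ) 1) := ⟨⟨1 / 2, by norm_num⟩⟩
    have hex := fun n => hexplog _ (hrkmem k n).1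
    obtain ⟨x, hx, hxlim⟩ := exists_seq_of_eventually_exists (α := Set.Ioo (0:ℝ) 1)
      (P := fun n x => 0 < e * (rk k n - x) ∧ u n x = U x)
      (g := fun n x => u n x / u n (rk k n) - 1) (fun ρ hρ => by
        have h := eventually_exists_crossing (t := fun n => Real.log (1 / rk k n))
          (w := fun n t => u n (Real.exp (-t))) (U := U) (e := e)
          hp1 hc₀ hτ₀ hH3 hlam (fun n => (hlog n).2.2) hwpos (fun n => (hlog n).1)
          (fun n => (hlog n).2.1) (by simpa only [hex] using hwk k)
          (by simpa only [hex] using hratio k) (hApos k) (by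
            refine (hrkphi k).congr fun n => ?_
            rw [hex, show -2 * Real.log (1 / rk k n) = -Real.log (1 / rk k n) +
              -Real.log (1 / rk k n) by ring, Real.exp_add, hex, sq])
          hr₁ hUcont hUlow (by simpa only [hex] using hUlt k) he hρ
        filter_upwards [h, (hwk k).eventually_gt_atTop 0] with n ⟨s, hs, hes, hsU, hsρ⟩ hn
        simp only [hex] at hsρ
        refine ⟨⟨_, hexpmem s hs⟩, ⟨?_, hsU⟩, ?_⟩
        · have hmono : ∀ s t : ℝ, 0 < s - t → 0 < Real.exp (-t) - Real.exp (-s) := fun s t h =>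
            sub_pos.2 (Real.exp_lt_exp.2 (by linarith))
          rw [← hex n]
          rcases he with rfl | rfl
          · rw [one_mul] at hes ⊢
            exact hmono _ _ hes
          · have := hmono (Real.log (1 / rk k n)) s (by linarith)
            linarith
        · rw [div_sub_one hn.ne', abs_div, abs_of_pos hn, div_le_iff₀ hn]
          exact hsρ)
    refine ⟨fun n => x n, fun n => (x n).2, ?_, hx⟩
    have h1 := (hxlim.add_const 1).mul (hrku k)
    rw [zero_add, one_mul] at h1
    refine h1.congr' ?_
    filter_upwards [(hwk k).eventually_gt_atTop 0] with n hn
    have := hμ n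
    field_simp
    ring
  choose rm hrm hrmlim hrmU using fun k => hcross k 1 (Or.inl rfl)
  choose rp hrp hrplim hrpU using fun k => hcross k (-1) (Or.inr rfl)
  have hpair : ∀ k, ∀ᶠ n in atTop, rm k n < rk k n ∧ rk k n < rp k n ∧
      u n (rm k n) = U (rm k n) ∧ u n (rp k n) = U (rp k n) := fun k => by
    filter_upwards [hrmU k, hrpU k] with n h1 h2
    exact ⟨by linarith [h1.1], by linarith [h2.1], h1.2, h2.2⟩
  have hcount : ∀ k, ∀ᶠ n in atTop, ZeroCountAtLeast (Set.Ioc 0 (rp k n))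
      (fun x => u n x - U x) (2 * (k + 1)) := by
    intro k
    have hlt : ∀ j, (δ j + δ (j + 1)) / 2 < δ j ∧ δ (j + 1) < (δ j + δ (j + 1)) / 2 := fun j => by
      have := hb.delta_strictAnti (Nat.lt_succ_self j)
      constructor <;> simp only [Nat.succ_eq_add_one] at this <;> linarith
    have hsep : ∀ j, ∀ᶠ n in atTop, u n (rm (j + 1) n) < (δ j + δ (j + 1)) / 2 * μ n ∧
        (δ j + δ (j + 1)) / 2 * μ n < u n (rp j n) := fun j => by
      filter_upwards [(hrmlim (j + 1)).eventually_lt_const (hlt j).2,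
        (hrplim j).eventually_const_lt (hlt j).1] with n h1 h2
      exact ⟨(div_lt_iff₀ (hμ n)).1 h1, (lt_div_iff₀ (hμ n)).1 h2⟩
    have hall := (Set.finite_Iic k).eventually_all.2 fun j _ => (hpair j).and (hsep j)
    filter_upwards [hall] with n hn
    refine zeroCountAtLeast_of_levels (x := fun j => rm j n) (y := fun j => rp j n) (hanti n) k
      (fun j => hrm j n) (fun j => hrp j n) (fun j hj => ?_) (fun j hj => ?_) (fun j hj => ?_)
      (fun j hj => (hn j (Set.mem_Iic.2 hj.le)).2.1) (fun j hj => (hn j (Set.mem_Iic.2 hj.le)).2.2)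
    · exact (hn j hj).1.1.trans (hn j hj).1.2.1
    · exact sub_eq_zero.2 (hn j hj).1.2.2.1
    · exact sub_eq_zero.2 (hn j hj).1.2.2.2
  refine ⟨id, strictMono_id, fun k => ⟨rm k, rp k, hrm k, hrp k, hrmlim k, hrplim k, hpair k,
    hcount k⟩, fun r hr hr0 N => ?_⟩
  filter_upwards [hcount N, hr0.eventually_lt_const (half_pos (hb.delta_pos N)),
    (hrplim N).eventually_const_lt (half_lt_self (hb.delta_pos N))] with n ⟨S, hS, hcard⟩ h1 h2
  have hlt : rp N n < r n := by
    refine hanti n _ (hr n) _ (hrp N n) ?_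
    have h3 := h1.trans h2
    exact (div_lt_div_iff_of_pos_right (hμ n)).1 h3
  exact ⟨S, fun z hz => ⟨⟨(hS hz).1.1, (hS hz).1.2.trans_lt hlt⟩, (hS hz).2⟩, by omega⟩
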